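/- arXiv:2112.14670 — 2 statements merged into one kernel-verified Lean document; each statement's English description precedes it below -/
import Mathlib

section
/- Relation between Δ-ice and Δ′-ice partition functions: for every strict partition μ = (μ_1 > ⋯ > μ_r ≥ 0) with μ_1 < N, every θ ∈ (ℤ/nℤ)^r, every v ∈ ℂ, every function g : ℤ/nℤ → ℂ, and all (z_1,…,z_r) ∈ (ℂ*)^r: Z^Δ_{μ,θ}(z_1,…,z_r) = (∏_{i=1}^r z_i^{θ_i}) · Z^{Δ′}_{μ,θ}(z_1,…,z_r), where each θ_i is identified with its representative in {0,…,n−1}. -/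
noncomputable section

/-- A spin: either `+` (`none`) or a supercolor `c̄_i` represented by the residue class
`i mod n` of its index `i ∈ {0, …, n − 1}` (`some` of that class). -/
abbrev Spin (n : ℕ) := Option (ZMod n)

/-- The Δ′-weights of a vertex with column supercolor (class) `j` and row parameter `z`,
on the spins `(a, b, c, d)` of its (left, top, right, bottom) edges; inadmissible
configurations get weight `0`. -/
def wtD' (n : ℕ) (v : ℂ) (g : ZMod n → ℂ) (j : ZMod n) (z : ℂ) :
    Spin n → Spin n → Spin n → Spin n → ℂ
  | some a, some b, some c, some d =>
      if b = j ∧ d = j ∧ c = a then (if a = j then g (a - j) * z ^ n else g (a - j)) else 0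
  | none, some b, none, some d => if b = j ∧ d = j then 1 else 0
  | some a, none, some c, none => if c = a then (if a = j then z ^ n else 1) else 0
  | some a, none, none, some d => if a = j ∧ d = j then (1 - v) * z ^ n else 0
  | none, some b, some c, none => if b = j ∧ c = j then 1 else 0
  | none, none, none, none => 1
  | _, _, _, _ => 0

/-- The Δ-weights of a vertex with column supercolor (class) `j` and row parameter `z`,
on the spins `(a, b, c, d)` of its (left, top, right, bottom) edges; inadmissible
configurations get weight `0`. -/
def wtD (n : ℕ) (v : ℂ) (g : ZMod n → ℂ) (j : ZMod n) (z : ℂ) :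
    Spin n → Spin n → Spin n → Spin n → ℂ
  | some a, some b, some c, some d => if b = j ∧ d = j ∧ c = a then g (a - j) * z else 0
  | none, some b, none, some d => if b = j ∧ d = j then 1 else 0
  | some a, none, some c, none => if c = a then z else 0
  | some a, none, none, some d => if a = j ∧ d = j then (1 - v) * z else 0
  | none, some b, some c, none => if b = j ∧ c = j then 1 else 0
  | none, none, none, none => 1
  | _, _, _, _ => 0

/-- The admissible configurations `(a, b, c, d)` = (left, top, right, bottom) of a
vertex with column supercolor (class) `j`. -/
def AdmD (n : ℕ) (j : ZMod n) (a b c d : Spin n) : Prop :=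
  (a = none ∧ b = none ∧ c = none ∧ d = none) ∨
  (∃ i : ZMod n, a = some i ∧ b = some j ∧ c = some i ∧ d = some j) ∨
  (a = none ∧ b = some j ∧ c = none ∧ d = some j) ∨
  (∃ i : ZMod n, a = some i ∧ b = none ∧ c = some i ∧ d = none) ∨
  (a = some j ∧ b = none ∧ c = none ∧ d = some j) ∨
  (a = none ∧ b = some j ∧ c = some j ∧ d = none)

/-- A spin configuration of the `r × N` grid: `s.1 i p` is the spin of the horizontal
edge of row `i` which is the right edge of column `p` (so `s.1 i 0` is the right
boundary edge of row `i` and `s.1 i (Fin.last N)` the left boundary edge), and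
`s.2 i k` records whether the vertical edge of column `k` on row-boundary `i` is
occupied (columns are numbered `0, …, N − 1` from the right). -/
abbrev GState (n r N : ℕ) := (Fin r → Fin (N + 1) → Spin n) × (Fin (r + 1) → Fin N → Bool)

/-- The column supercolor (class) of column number `k`: `c̄_{k mod n}`. -/
def colCD (n k : ℕ) : ZMod n := (k : ZMod n)

/-- The spin of the vertical edge of column `k` on row-boundary `i`. -/
def vspinD {n r N : ℕ} (s : GState n r N) (i : Fin (r + 1)) (k : Fin N) : Spin n :=
  if s.2 i k then some (colCD n k) else none

/-- `s` is an admissible state of the system `𝔖̄ⁿ_{μ,θ}`: the left and bottom boundary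
edges carry `+`, the top boundary vertical edge in column `k` is occupied iff `k` is a
part of `μ`, the right boundary edge of row `i` carries the supercolor `c̄_{θ_i}`, and
every vertex is in an admissible configuration. -/
def IsStateD {n r N : ℕ} (μ : Fin r → ℕ) (θ : Fin r → ZMod n) (s : GState n r N) : Prop :=
  (∀ i, s.1 i (Fin.last N) = none) ∧
  (∀ i, s.1 i 0 = some (θ i)) ∧
  (∀ k : Fin N, (s.2 0 k = true ↔ ∃ i, μ i = (k : ℕ))) ∧
  (∀ k, s.2 (Fin.last r) k = false) ∧
  (∀ (i : Fin r) (k : Fin N),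
    AdmD n (colCD n k) (s.1 i k.succ) (vspinD s i.castSucc k) (s.1 i k.castSucc)
      (vspinD s i.succ k))

open Classical in
/-- The Δ-ice partition function `Z^Δ_{μ,θ}(z)`. -/
def ZD (n : ℕ) [NeZero n] (r N : ℕ) (v : ℂ) (g : ZMod n → ℂ)
    (μ : Fin r → ℕ) (θ : Fin r → ZMod n) (z : Fin r → ℂ) : ℂ :=
  ∑ s : GState n r N,
    if IsStateD μ θ s then
      ∏ i : Fin r, ∏ k : Fin N,
        wtD n v g (colCD n k) (z i) (s.1 i k.succ) (vspinD s i.castSucc k)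
          (s.1 i k.castSucc) (vspinD s i.succ k)
    else 0

open Classical in
/-- The Δ′-ice partition function `Z^{Δ′}_{μ,θ}(z)`. -/
def ZD' (n : ℕ) [NeZero n] (r N : ℕ) (v : ℂ) (g : ZMod n → ℂ)
    (μ : Fin r → ℕ) (θ : Fin r → ZMod n) (z : Fin r → ℂ) : ℂ :=
  ∑ s : GState n r N,
    if IsStateD μ θ s then
      ∏ i : Fin r, ∏ k : Fin N,
        wtD' n v g (colCD n k) (z i) (s.1 i k.succ) (vspinD s i.castSucc k)
          (s.1 i k.castSucc) (vspinD s i.succ k)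
    else 0

theorem val_sub_one_add_one {n : ℕ} [NeZero n] (x : ZMod n) :
    (x - 1).val + 1 = x.val + if x = 0 then n else 0 := by
  obtain ⟨m, rfl⟩ := Nat.exists_eq_succ_of_ne_zero (NeZero.ne n)
  split_ifs with hx
  · simp [hx, ZMod.val_neg_one]
  · have hpos : 0 < x.val := Nat.pos_of_ne_zero ((ZMod.val_ne_zero x).2 hx)
    have hlt := ZMod.val_lt x
    have : Fact (1 < m.succ) := ⟨by omega⟩
    rw [ZMod.val_sub (by rw [ZMod.val_one]; omega), ZMod.val_one]
    omega

theorem prod_mul_last_eq_prod_mul_zero {M : Type*} [CommMonoid M] {N : ℕ} (A B : Fin N → M)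
    (f : Fin (N + 1) → M) (h : ∀ k, A k * f k.succ = B k * f k.castSucc) :
    (∏ k, A k) * f (Fin.last N) = (∏ k, B k) * f 0 := by
  induction N with
  | zero => simp
  | succ N ih =>
    have ih' := ih (fun k => A k.castSucc) (fun k => B k.castSucc) (fun k => f k.castSucc)
      fun k => by simpa using h k.castSucc
    have hl := h (Fin.last N)
    rw [Fin.succ_last] at hl
    rw [Fin.prod_univ_castSucc, Fin.prod_univ_castSucc, mul_assoc, hl, mul_left_comm, ih',
      Fin.castSucc_zero, mul_left_comm, mul_assoc, mul_left_comm]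

/-- The ratio of Δ-weights to Δ′-weights accumulated in a row to the left of the right edge of
column `p`, as a function of the spin of that edge. -/
def edgePot {n : ℕ} (z : ℂ) (p : ℕ) : Spin n → ℂ
  | none => 1
  | some a => z ^ (a - (p : ZMod n)).val

theorem mul_edgePot_succ {n : ℕ} [NeZero n] (z : ℂ) (k : ℕ) (a : ZMod n) :
    z * edgePot z (k + 1) (some a) =
      (if a = colCD n k then z ^ n else 1) * edgePot z k (some a) := by
  have h := val_sub_one_add_one (a - (k : ZMod n))
  rw [sub_sub] at h
  simp only [edgePot, colCD, Nat.cast_add, Nat.cast_one, ← pow_succ', h]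
  by_cases ha : a = (k : ZMod n)
  · simp [ha]
  · simp [ha, sub_eq_zero]

theorem wtD_mul_edgePot {n : ℕ} [NeZero n] (v : ℂ) (g : ZMod n → ℂ) (k : ℕ) (z : ℂ)
    (a b c d : Spin n) :
    wtD n v g (colCD n k) z a b c d * edgePot z (k + 1) a =
      wtD' n v g (colCD n k) z a b c d * edgePot z k c := by
  have hcol : edgePot z k (some (colCD n k)) = 1 := by simp [edgePot, colCD]
  have hnone (p : ℕ) : edgePot (n := n) z p none = 1 := rfl
  rcases a with _ | a
  · rcases b with _ | b <;> rcases c with _ | c <;> rcases d with _ | d <;>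
      simp only [wtD, wtD', hnone, zero_mul]
    split_ifs with h
    · rw [h.2, hcol]
    · simp
  · have ha := mul_edgePot_succ z k a
    rcases b with _ | b <;> rcases c with _ | c <;> rcases d with _ | d <;>
      simp only [wtD, wtD', hnone, zero_mul]
    · split_ifs <;> simp_all [mul_assoc]
    · split_ifs <;> simp_all
    · split_ifs <;> simp_all [mul_assoc]

/-- the Δ-ice and Δ′-ice partition functions are related by
`Z^Δ_{μ,θ}(z) = (∏_i z_i^{θ_i}) · Z^{Δ′}_{μ,θ}(z)`, where each `θ_i` is identified
with its representative in `{0, …, n − 1}`. -/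
theorem delta_deltaPrime_relation
    (n : ℕ) [NeZero n] (r N : ℕ) (v : ℂ) (g : ZMod n → ℂ)
    (μ : Fin r → ℕ) (hμ : StrictAnti μ) (hμN : ∀ i, μ i < N)
    (θ : Fin r → ZMod n) (z : Fin r → ℂ) (hz : ∀ i, z i ≠ 0) :
    ZD n r N v g μ θ z = (∏ i, z i ^ (θ i).val) * ZD' n r N v g μ θ z := by
  simp only [ZD, ZD', Finset.mul_sum]
  refine Finset.sum_congr rfl fun s _ => ?_
  split_ifs with hs
  · obtain ⟨hleft, hright, -, -, -⟩ := hs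
    rw [← Finset.prod_mul_distrib]
    refine Finset.prod_congr rfl fun i _ => ?_
    have h := prod_mul_last_eq_prod_mul_zero _ _
      (fun p : Fin (N + 1) => edgePot (z i) p (s.1 i p))
      (fun k : Fin N => wtD_mul_edgePot v g k (z i) (s.1 i k.succ)
        (vspinD s i.castSucc k) (s.1 i k.castSucc) (vspinD s i.succ k))
    simpa [hleft, hright, edgePot, mul_comm] using h
  · simp
end
end

section
/- Vanishing criterion for constant supercolor boundary (vanishing part of the metaplectic Tokuyama formula): if θ = (c, c, …, c) ∈ (ℤ/nℤ)^r for some c ∈ ℤ/nℤ, then the system 𝔖̄ⁿ_{μ,θ} has no admissible states — hence Z^Δ_{μ,θ} = Z^{Δ′}_{μ,θ} = 0 — unless μ_i ≡ c (mod n) for every i = 1, …, r; equivalently, unless μ = n(λ+ρ) + c·(1,…,1) for a unique partition λ = (λ_1 ≥ ⋯ ≥ λ_r ≥ 0), where ρ = (r−1, r−2, …, 1, 0) and c is identified with its representative in {0,…,n−1}. -/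
noncomputable section

/-- The number of edges (`0` or `1`) of spin `x` carrying the supercolor `d`. -/
def colorCount {n : ℕ} (d : ZMod n) (x : Spin n) : ℕ := if x = some d then 1 else 0

theorem colorCount_none {n : ℕ} (d : ZMod n) : colorCount d none = 0 := by
  simp [colorCount]

/-- Every supercolor is conserved at an admissible vertex. -/
theorem AdmD.colorCount_add {n : ℕ} {j : ZMod n} {x y x' y' : Spin n} (h : AdmD n j x y x' y')
    (d : ZMod n) :
    colorCount d x + colorCount d y = colorCount d x' + colorCount d y' := by
  rcases h with ⟨rfl, rfl, rfl, rfl⟩ | ⟨i, rfl, rfl, rfl, rfl⟩ | ⟨rfl, rfl, rfl, rfl⟩ |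
    ⟨i, rfl, rfl, rfl, rfl⟩ | ⟨rfl, rfl, rfl, rfl⟩ | ⟨rfl, rfl, rfl, rfl⟩ <;>
  simp [colorCount_none]

/-- Every supercolor is conserved across a row of an admissible state. -/
theorem IsStateD.row_colorCount {n r N : ℕ} {μ : Fin r → ℕ} {θ : Fin r → ZMod n}
    {s : GState n r N} (hs : IsStateD μ θ s) (d : ZMod n) (i : Fin r) :
    ∑ k, colorCount d (vspinD s i.castSucc k) =
      colorCount d (some (θ i)) + ∑ k, colorCount d (vspinD s i.succ k) := by
  obtain ⟨hleft, hright, -, -, hvertex⟩ := hs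
  have hrow := Finset.sum_congr (rfl : (Finset.univ : Finset (Fin N)) = Finset.univ)
    fun k _ => (hvertex i k).colorCount_add d
  rw [Finset.sum_add_distrib, Finset.sum_add_distrib] at hrow
  have hfirst := Fin.sum_univ_succ fun p => colorCount d (s.1 i p)
  have hlast := Fin.sum_univ_castSucc fun p => colorCount d (s.1 i p)
  rw [hright i] at hfirst
  rw [hleft i, colorCount_none] at hlast
  omega

/-- If the supercolor `d` does not leave through the right boundary, then no vertical edge
carries it. -/
theorem IsStateD.sum_colorCount_eq_zero {n r N : ℕ} {μ : Fin r → ℕ} {θ : Fin r → ZMod n}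
    {s : GState n r N} (hs : IsStateD μ θ s) {d : ZMod n} (hd : ∀ i, θ i ≠ d)
    (i : Fin (r + 1)) : ∑ k, colorCount d (vspinD s i k) = 0 := by
  induction i using Fin.reverseInduction with
  | last => simp [vspinD, hs.2.2.2.1, colorCount_none]
  | cast i ih => rw [hs.row_colorCount d i, ih]; simp [colorCount, hd i]

/-- The supercolor of every occupied top edge occurs on the right boundary. -/
theorem IsStateD.exists_eq_natCast {n r N : ℕ} {μ : Fin r → ℕ} {θ : Fin r → ZMod n}
    {s : GState n r N} (hs : IsStateD μ θ s) {i : Fin r} (hi : μ i < N) :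
    ∃ j, θ j = (μ i : ZMod n) := by
  by_contra! h
  have hzero := Finset.sum_eq_zero_iff.mp (hs.sum_colorCount_eq_zero h 0) ⟨μ i, hi⟩
    (Finset.mem_univ _)
  have htop : s.2 0 ⟨μ i, hi⟩ = true := (hs.2.2.1 ⟨μ i, hi⟩).mpr ⟨i, rfl⟩
  simp [colorCount, vspinD, htop, colCD] at hzero

theorem StrictAnti.fin_add_le {r : ℕ} {q : Fin r → ℕ} (hq : StrictAnti q) {i j : Fin r}
    (hij : i ≤ j) : q j + j ≤ q i + i := by
  obtain ⟨j, hj⟩ := j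
  obtain ⟨i, hi⟩ := i
  simp only [Fin.mk_le_mk] at hij ⊢
  induction j, hij using Nat.le_induction with
  | base => rfl
  | succ m hm ih =>
    have hstep : q ⟨m + 1, hj⟩ < q ⟨m, by omega⟩ := hq (by simp)
    have := ih (by omega)
    omega

theorem antitone_sub_of_strictAnti {r : ℕ} {q : Fin r → ℕ} (hq : StrictAnti q) :
    Antitone fun i : Fin r => q i - (r - 1 - (i : ℕ)) := by
  intro i j hij
  have := hq.fin_add_le hij
  dsimp only
  omega

theorem StrictAnti.sub_one_sub_le {r : ℕ} {q : Fin r → ℕ} (hq : StrictAnti q) (i : Fin r) :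
    r - 1 - (i : ℕ) ≤ q i := by
  have hi := i.isLt
  have hij : i ≤ ⟨r - 1, by omega⟩ := Fin.le_def.mpr (by dsimp only; omega)
  have h := hq.fin_add_le hij
  dsimp only at h
  omega

/-- A strict partition has all its parts congruent to `c` modulo `n` iff it is
`n (lam + ρ) + c` for a unique partition `lam`. -/
theorem forall_natCast_eq_iff_existsUnique {n r : ℕ} [NeZero n] {μ : Fin r → ℕ}
    (hμ : StrictAnti μ) (c : ZMod n) :
    (∀ i, (μ i : ZMod n) = c) ↔
      ∃! lam : Fin r → ℕ, Antitone lam ∧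
        ∀ i : Fin r, μ i = n * (lam i + (r - 1 - (i : ℕ))) + c.val := by
  constructor
  · intro h
    have hdiv (i : Fin r) : μ i = n * (μ i / n) + c.val := by
      rw [← h i, ZMod.val_natCast, Nat.div_add_mod]
    have hq : StrictAnti fun i => μ i / n := fun i j hij => by
      have hlt := hμ hij
      rw [hdiv i, hdiv j] at hlt
      exact lt_of_mul_lt_mul_left (Nat.lt_of_add_lt_add_right hlt) n.zero_le
    refine ⟨fun i => μ i / n - (r - 1 - (i : ℕ)), ⟨antitone_sub_of_strictAnti hq, fun i => ?_⟩,
      fun lam hlam => funext fun i => ?_⟩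
    · dsimp only
      rw [Nat.sub_add_cancel (hq.sub_one_sub_le i)]
      exact hdiv i
    · have heq := Nat.add_right_cancel ((hlam.2 i).symm.trans (hdiv i))
      have := Nat.eq_of_mul_eq_mul_left (NeZero.pos n) heq
      omega
  · rintro ⟨lam, ⟨-, hlam⟩, -⟩ i
    rw [hlam i]
    simp

/-- vanishing criterion for constant supercolor boundary: if
`θ = (c, …, c)`, then `𝔖̄ⁿ_{μ,θ}` has no admissible states — hence
`Z^Δ_{μ,θ} = Z^{Δ′}_{μ,θ} = 0` — unless `μ_i ≡ c (mod n)` for every `i`; equivalently,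
unless `μ = n(λ + ρ) + c·(1, …, 1)` for a unique partition `λ`, where
`ρ = (r − 1, …, 1, 0)` and `c` is identified with its representative in
`{0, …, n − 1}`. -/
theorem constant_supercolor_vanishing
    (n : ℕ) [NeZero n] (r N : ℕ) (v : ℂ) (g : ZMod n → ℂ)
    (μ : Fin r → ℕ) (hμ : StrictAnti μ) (hμN : ∀ i, μ i < N)
    (c : ZMod n) (θ : Fin r → ZMod n) (hθ : ∀ i, θ i = c) :
    ((¬ ∀ i, (μ i : ZMod n) = c) →
      (¬ ∃ s : GState n r N, IsStateD μ θ s) ∧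
        ∀ z : Fin r → ℂ, ZD n r N v g μ θ z = 0 ∧ ZD' n r N v g μ θ z = 0) ∧
    ((∀ i, (μ i : ZMod n) = c) ↔
      ∃! lam : Fin r → ℕ, Antitone lam ∧
        ∀ i : Fin r, μ i = n * (lam i + (r - 1 - (i : ℕ))) + c.val) := by
  refine ⟨fun h => ?_, forall_natCast_eq_iff_existsUnique hμ c⟩
  have hempty : ∀ s : GState n r N, ¬ IsStateD μ θ s := fun s hs => h fun i => by
    obtain ⟨j, hj⟩ := hs.exists_eq_natCast (hμN i)
    rw [← hj, hθ j]
  exact ⟨fun ⟨s, hs⟩ => hempty s hs, fun z => ⟨by simp [ZD, hempty], by simp [ZD', hempty]⟩⟩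
end
end
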